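/- arXiv:1910.05742 — 2 statements merged into one kernel-verified Lean document; each statement's English description precedes it below -/
import Mathlib

section
/- Let k, l ∈ ℝ³ with k ≠ 0 and k ≠ l. Then the 3×3 matrices (k−l)⊗(k−l)/|k−l|² and k⊗k/|k|² satisfy ‖ (k−l)⊗(k−l)/|k−l|² − k⊗k/|k|² ‖ ≤ 4 |l| / |k|, where ‖·‖ denotes the operator norm on 3×3 real matrices. -/
open scoped RealInnerProductSpace

noncomputable section

/-- The outer product `a ⊗ b` of two vectors of `ℝ³`, viewed as the linear operator
`x ↦ (b·x) a` on `ℝ³` (its matrix has entries `a i * b j`); the operator norm of such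
operators is exactly the operator norm of the corresponding `3×3` matrix induced by the
Euclidean norm. -/
def outer (a b : EuclideanSpace ℝ (Fin 3)) :
    EuclideanSpace ℝ (Fin 3) →L[ℝ] EuclideanSpace ℝ (Fin 3) :=
  (innerSL ℝ b).smulRight a

lemma norm_outer (a b : EuclideanSpace ℝ (Fin 3)) : ‖outer a b‖ = ‖b‖ * ‖a‖ := by
  simp [outer, ContinuousLinearMap.norm_smulRight_apply]

lemma outer_smul_smul (c : ℝ) (a : EuclideanSpace ℝ (Fin 3)) :
    outer (c • a) (c • a) = (c ^ 2) • outer a a := by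
  ext1 x
  simp [outer, smul_smul]
  ring_nf

lemma norm_outer_self_sub_outer_self_le (u v : EuclideanSpace ℝ (Fin 3)) :
    ‖outer u u - outer v v‖ ≤ (‖u‖ + ‖v‖) * ‖u - v‖ := by
  have h : outer u u - outer v v = outer (u - v) u + outer v (u - v) := by
    ext1 x
    simp [outer, smul_sub, sub_smul]
  rw [h]
  refine (norm_add_le _ _).trans_eq ?_
  rw [norm_outer, norm_outer]
  ring

/-- Normalizing vectors is Lipschitz away from the origin. -/
lemma norm_normalize_sub_normalize_le {E : Type*} [NormedAddCommGroup E] [NormedSpace ℝ E]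
    {x y : E} (hx : x ≠ 0) (hy : y ≠ 0) :
    ‖‖x‖⁻¹ • x - ‖y‖⁻¹ • y‖ ≤ 2 * ‖x - y‖ / ‖y‖ := by
  have hx' : ‖x‖ ≠ 0 := norm_ne_zero_iff.mpr hx
  have hy' : 0 < ‖y‖ := norm_pos_iff.mpr hy
  have h : ‖y‖ • (‖x‖⁻¹ • x - ‖y‖⁻¹ • y) = (‖y‖ - ‖x‖) • (‖x‖⁻¹ • x) + (x - y) := by
    rw [smul_sub, sub_smul, smul_inv_smul₀ hy'.ne', smul_inv_smul₀ hx']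
    abel
  have hu : ‖‖x‖⁻¹ • x‖ = 1 := by simpa using norm_smul_inv_norm (𝕜 := ℝ) hx
  have hs := norm_smul ‖y‖ (‖x‖⁻¹ • x - ‖y‖⁻¹ • y)
  rw [norm_norm, h] at hs
  rw [le_div_iff₀ hy', mul_comm, ← hs]
  refine (norm_add_le _ _).trans ?_
  rw [norm_smul, hu, mul_one, two_mul, norm_sub_rev x y]
  gcongr
  exact abs_norm_sub_norm_le y x

/-- For `k, l ∈ ℝ³` with `k ≠ 0` and `k ≠ l`, the operator norm of the difference of the
projection-type matrices `(k−l)⊗(k−l)/|k−l|²` and `k⊗k/|k|²` is at most `4|l|/|k|`. -/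
theorem stmt4 (k l : EuclideanSpace ℝ (Fin 3)) (hk : k ≠ 0) (hkl : k ≠ l) :
    ‖(‖k - l‖ ^ 2)⁻¹ • outer (k - l) (k - l) - (‖k‖ ^ 2)⁻¹ • outer k k‖ ≤
      4 * ‖l‖ / ‖k‖ := by
  have hkl' : k - l ≠ 0 := sub_ne_zero.mpr hkl
  rw [← inv_pow, ← inv_pow, ← outer_smul_smul, ← outer_smul_smul]
  refine (norm_outer_self_sub_outer_self_le _ _).trans ?_
  have h := norm_normalize_sub_normalize_le hkl' hk
  rw [sub_sub_cancel_left, norm_neg] at h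
  have hu : ‖‖k - l‖⁻¹ • (k - l)‖ = 1 := by
    simpa using norm_smul_inv_norm (𝕜 := ℝ) hkl'
  have hv : ‖‖k‖⁻¹ • k‖ = 1 := by simpa using norm_smul_inv_norm (𝕜 := ℝ) hk
  rw [hu, hv]
  calc _ ≤ (1 + 1) * (2 * ‖l‖ / ‖k‖) := by gcongr
    _ = _ := by ring
end
end

section
/- Let e, a ∈ ℝ³ be unit vectors with e·a = 0, let γ ∈ ℝ, and let 0 < r < R. Then ∫_{{x∈ℝ³ : r ≤ |x| ≤ R}} |x|^{−2γ} (1 − (x·e)²/|x|²) (a·x) (x/|x|²) dx = (4/15) ( ∫_{{x∈ℝ³ : r ≤ |x| ≤ R}} |x|^{−2γ} dx ) a, where the left-hand integral is the componentwise Lebesgue integral of an ℝ³-valued function. -/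
open scoped RealInnerProductSpace
open MeasureTheory

/-- The closed annulus `{r ≤ |x| ≤ R}`. -/
abbrev closedAnnulus (E : Type*) [NormedAddCommGroup E] (r R : ℝ) : Set E :=
  {x : E | r ≤ ‖x‖ ∧ ‖x‖ ≤ R}

theorem isClosed_closedAnnulus {E : Type*} [NormedAddCommGroup E] (r R : ℝ) :
    IsClosed (closedAnnulus E r R) :=
  (isClosed_le continuous_const continuous_norm).inter
    (isClosed_le continuous_norm continuous_const)

theorem isCompact_closedAnnulus {E : Type*} [NormedAddCommGroup E] [ProperSpace E] (r R : ℝ) :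
    IsCompact (closedAnnulus E r R) :=
  (isCompact_closedBall (0 : E) R).of_isClosed_subset (isClosed_closedAnnulus r R)
    fun x hx => by simpa using hx.2

section RadialMoments

variable {E : Type*} [NormedAddCommGroup E] [InnerProductSpace ℝ E] [FiniteDimensional ℝ E]
  [MeasurableSpace E] [BorelSpace E]

theorem setIntegral_closedAnnulus_comp_isometry {F : Type*} [NormedAddCommGroup F]
    [NormedSpace ℝ F] (L : E ≃ₗᵢ[ℝ] E) (f : E → F) (r R : ℝ) :
    ∫ x in closedAnnulus E r R, f (L x) = ∫ x in closedAnnulus E r R, f x := by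
  have h := L.measurePreserving.setIntegral_preimage_emb
    L.toHomeomorph.measurableEmbedding f (closedAnnulus E r R)
  have hs : L ⁻¹' closedAnnulus E r R = closedAnnulus E r R := by
    ext x
    simp [closedAnnulus]
  rwa [hs] at h

theorem setIntegral_closedAnnulus_inner_eq {u v : E} (huv : ‖u‖ = ‖v‖) (f : ℝ → ℝ → ℝ)
    (r R : ℝ) :
    ∫ x in closedAnnulus E r R, f ‖x‖ ⟪u, x⟫ = ∫ x in closedAnnulus E r R, f ‖x‖ ⟪v, x⟫ := by
  let L := (ℝ ∙ (u - v))ᗮ.reflection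
  have hL : L u = v := Submodule.reflection_sub huv
  rw [← setIntegral_closedAnnulus_comp_isometry L (fun x => f ‖x‖ ⟪v, x⟫)]
  simp_rw [← hL, LinearIsometryEquiv.norm_map, LinearIsometryEquiv.inner_map_map]

theorem setIntegral_closedAnnulus_eq_zero_of_odd {a : E} {f : E → ℝ}
    (hf : ∀ x, f ((ℝ ∙ a)ᗮ.reflection x) = -f x) (r R : ℝ) :
    ∫ x in closedAnnulus E r R, f x = 0 := by
  have h := setIntegral_closedAnnulus_comp_isometry (ℝ ∙ a)ᗮ.reflection f r R
  simp_rw [hf, integral_neg] at h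
  linarith

variable {ι : Type*} [Fintype ι] {r R : ℝ} {φ : ℝ → ℝ}

theorem integrableOn_closedAnnulus_radial_mul (hr : 0 < r) (hφ : ContinuousOn φ (Set.Icc r R))
    {p : E → ℝ} (hp : Continuous p) (k : ℕ) :
    IntegrableOn (fun x => φ ‖x‖ * (p x / ‖x‖ ^ k)) (closedAnnulus E r R) := by
  refine ContinuousOn.integrableOn_compact (isCompact_closedAnnulus r R) ?_
  refine (hφ.comp continuous_norm.continuousOn fun x hx => hx).mul
    (hp.continuousOn.div (by fun_prop) fun x hx => ?_)
  have := hr.trans_le hx.1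
  positivity

theorem setIntegral_closedAnnulus_inner_sq (b : OrthonormalBasis ι ℝ E) (hr : 0 < r)
    (hφ : ContinuousOn φ (Set.Icc r R)) {u : E} (hu : ‖u‖ = 1) :
    Fintype.card ι * ∫ x in closedAnnulus E r R, φ ‖x‖ * (⟪u, x⟫ ^ 2 / ‖x‖ ^ 2) =
      ∫ x in closedAnnulus E r R, φ ‖x‖ := by
  have h1 : ∀ i, ∫ x in closedAnnulus E r R, φ ‖x‖ * (⟪b i, x⟫ ^ 2 / ‖x‖ ^ 2) =
      ∫ x in closedAnnulus E r R, φ ‖x‖ * (⟪u, x⟫ ^ 2 / ‖x‖ ^ 2) := fun i =>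
    setIntegral_closedAnnulus_inner_eq (by simp [hu]) (fun s t => φ s * (t ^ 2 / s ^ 2)) r R
  have h2 := integral_finsetSum (μ := volume.restrict (closedAnnulus E r R)) Finset.univ
    (f := fun i x => φ ‖x‖ * (⟪b i, x⟫ ^ 2 / ‖x‖ ^ 2))
    fun i _ => integrableOn_closedAnnulus_radial_mul hr hφ (by fun_prop) 2
  simp_rw [h1, Finset.sum_const, Finset.card_univ, nsmul_eq_mul] at h2
  rw [← h2]
  refine setIntegral_congr_fun (isClosed_closedAnnulus r R).measurableSet fun x hx => ?_
  have hx0 : ‖x‖ ≠ 0 := (hr.trans_le hx.1).ne'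
  rw [← Finset.mul_sum, ← Finset.sum_div, b.sum_sq_inner_right, div_self (pow_ne_zero 2 hx0),
    mul_one]

theorem setIntegral_closedAnnulus_inner_pow_four (hr : 0 < r)
    (hφ : ContinuousOn φ (Set.Icc r R)) {u v : E} (hu : ‖u‖ = 1) (hv : ‖v‖ = 1)
    (huv : ⟪u, v⟫ = 0) :
    ∫ x in closedAnnulus E r R, φ ‖x‖ * (⟪u, x⟫ ^ 4 / ‖x‖ ^ 4) =
      3 * ∫ x in closedAnnulus E r R, φ ‖x‖ * (⟪u, x⟫ ^ 2 * ⟪v, x⟫ ^ 2 / ‖x‖ ^ 4) := by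
  have hadd : ‖u + v‖ = √2 := by
    rw [norm_add_eq_sqrt_iff_real_inner_eq_zero.2 huv, hu, hv]
    norm_num
  have hsub : ‖u - v‖ = √2 := by
    rw [norm_sub_eq_sqrt_iff_real_inner_eq_zero.2 huv, hu, hv]
    norm_num
  have hsmul : ‖√2 • u‖ = √2 := by
    rw [norm_smul, hu, Real.norm_of_nonneg (Real.sqrt_nonneg 2), mul_one]
  have heq : ∀ w : E, ‖w‖ = √2 →
      ∫ x in closedAnnulus E r R, φ ‖x‖ * (⟪w, x⟫ ^ 4 / ‖x‖ ^ 4) =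
      4 * ∫ x in closedAnnulus E r R, φ ‖x‖ * (⟪u, x⟫ ^ 4 / ‖x‖ ^ 4) := fun w hw => by
    rw [setIntegral_closedAnnulus_inner_eq (hw.trans hsmul.symm)
      (fun s t => φ s * (t ^ 4 / s ^ 4)) r R, ← integral_const_mul]
    congr 1 with x
    have h4 : √2 ^ 4 = 4 := by
      rw [show √2 ^ 4 = (√2 ^ 2) ^ 2 by ring, Real.sq_sqrt zero_le_two]
      norm_num
    rw [real_inner_smul_left, mul_pow, h4]
    ring
  have hvu := setIntegral_closedAnnulus_inner_eq (hv.trans hu.symm)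
    (fun s t => φ s * (t ^ 4 / s ^ 4)) r R
  have hint {p : E → ℝ} (hp : Continuous p) :
      IntegrableOn (fun x => φ ‖x‖ * (p x / ‖x‖ ^ 4)) (closedAnnulus E r R) :=
    integrableOn_closedAnnulus_radial_mul hr hφ hp 4
  have key : (∫ x in closedAnnulus E r R, φ ‖x‖ * (⟪u + v, x⟫ ^ 4 / ‖x‖ ^ 4)) +
      ∫ x in closedAnnulus E r R, φ ‖x‖ * (⟪u - v, x⟫ ^ 4 / ‖x‖ ^ 4) =
      2 * (∫ x in closedAnnulus E r R, φ ‖x‖ * (⟪u, x⟫ ^ 4 / ‖x‖ ^ 4)) +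
      2 * (∫ x in closedAnnulus E r R, φ ‖x‖ * (⟪v, x⟫ ^ 4 / ‖x‖ ^ 4)) +
      12 * ∫ x in closedAnnulus E r R, φ ‖x‖ * (⟪u, x⟫ ^ 2 * ⟪v, x⟫ ^ 2 / ‖x‖ ^ 4) := by
    rw [← integral_add (hint (by fun_prop)) (hint (by fun_prop)), ← integral_const_mul,
      ← integral_const_mul, ← integral_const_mul, ← integral_add, ← integral_add]
    · congr 1 with x
      rw [inner_add_left, inner_sub_left]
      ring
    · exact ((hint (by fun_prop)).const_mul 2).add ((hint (by fun_prop)).const_mul 2)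
    · exact (hint (by fun_prop)).const_mul 12
    · exact (hint (by fun_prop)).const_mul 2
    · exact (hint (by fun_prop)).const_mul 2
  rw [heq _ hadd, heq _ hsub] at key
  linarith

theorem setIntegral_closedAnnulus_inner_sq_mul_inner_sq (b : OrthonormalBasis ι ℝ E)
    (hr : 0 < r) (hφ : ContinuousOn φ (Set.Icc r R)) {i j : ι} (hij : i ≠ j) :
    (Fintype.card ι + 2) *
        ∫ x in closedAnnulus E r R, φ ‖x‖ * (⟪b i, x⟫ ^ 2 * ⟪b j, x⟫ ^ 2 / ‖x‖ ^ 4) =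
      ∫ x in closedAnnulus E r R, φ ‖x‖ * (⟪b j, x⟫ ^ 2 / ‖x‖ ^ 2) := by
  classical
  set m : ι → ℝ := fun k =>
    ∫ x in closedAnnulus E r R, φ ‖x‖ * (⟪b k, x⟫ ^ 2 * ⟪b j, x⟫ ^ 2 / ‖x‖ ^ 4) with hm
  have hfour : ∀ k, k ≠ j → m j = 3 * m k := fun k hk => by
    have h := setIntegral_closedAnnulus_inner_pow_four hr hφ (b.norm_eq_one j)
      (b.norm_eq_one k) (b.inner_eq_zero hk.symm)
    simp only [hm]
    convert h using 5
    · ring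
    · ring
  have hsum : ∑ k, m k = ∫ x in closedAnnulus E r R, φ ‖x‖ * (⟪b j, x⟫ ^ 2 / ‖x‖ ^ 2) := by
    rw [hm, ← integral_finsetSum _
      fun k _ => integrableOn_closedAnnulus_radial_mul hr hφ (by fun_prop) 4]
    refine setIntegral_congr_fun (isClosed_closedAnnulus r R).measurableSet fun x hx => ?_
    have hx0 : ‖x‖ ≠ 0 := (hr.trans_le hx.1).ne'
    rw [← Finset.mul_sum, ← Finset.sum_div, ← Finset.sum_mul, b.sum_sq_inner_right]
    field_simp
  have hite : ∀ k, m k = m i + if k = j then 2 * m i else 0 := fun k => by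
    split_ifs with hk
    · rw [hk, hfour i hij]
      ring
    · linarith [hfour k hk, hfour i hij]
  rw [← hsum, Finset.sum_congr rfl fun k _ => hite k, Finset.sum_add_distrib,
    Finset.sum_ite_eq' Finset.univ j]
  simp only [Finset.sum_const, Finset.card_univ, nsmul_eq_mul, Finset.mem_univ, if_true]
  ring

end RadialMoments

/-- For unit orthogonal vectors `e, a ∈ ℝ³`, any `γ ∈ ℝ` and radii `0 < r < R`, the
vector-valued integral of `|x|^{-2γ} (1 − (x·e)²/|x|²) (a·x) x/|x|²` over the annulus
`{r ≤ |x| ≤ R}` equals `(4/15) (∫_{annulus} |x|^{-2γ} dx) a`. -/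
theorem stmt10 (e a : EuclideanSpace ℝ (Fin 3)) (he : ‖e‖ = 1) (ha : ‖a‖ = 1)
    (hea : ⟪e, a⟫ = 0) (γ r R : ℝ) (hr : 0 < r) (hrR : r < R) :
    (∫ x in {x : EuclideanSpace ℝ (Fin 3) | r ≤ ‖x‖ ∧ ‖x‖ ≤ R},
        (‖x‖ ^ (-(2 * γ)) * (1 - ⟪x, e⟫ ^ 2 / ‖x‖ ^ 2) * ⟪a, x⟫ / ‖x‖ ^ 2) • x) =
      ((4 / 15) *
        ∫ x in {x : EuclideanSpace ℝ (Fin 3) | r ≤ ‖x‖ ∧ ‖x‖ ≤ R}, ‖x‖ ^ (-(2 * γ))) • a := by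
  have hae : ⟪a, e⟫ = 0 := by rw [real_inner_comm, hea]
  have hφ : ContinuousOn (fun s : ℝ => s ^ (-(2 * γ))) (Set.Icc r R) :=
    continuousOn_id.rpow_const fun s hs => Or.inl (hr.trans_le hs.1).ne'
  obtain ⟨b, hb⟩ := Orthonormal.exists_orthonormalBasis_extension_of_card_eq
    (𝕜 := ℝ) (E := EuclideanSpace ℝ (Fin 3)) (ι := Fin 3) (by simp) (v := ![e, a, 0])
    (s := {0, 1}) (by
      rw [orthonormal_iff_ite]
      rintro ⟨i, rfl | rfl⟩ ⟨j, rfl | rfl⟩ <;>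
        simp [Subtype.ext_iff, he, ha, hea, hae])
  have hb0 : b 0 = e := hb 0 (by simp)
  have hb1 : b 1 = a := hb 1 (by simp)
  have hint : IntegrableOn (fun x : EuclideanSpace ℝ (Fin 3) =>
      (‖x‖ ^ (-(2 * γ)) * (1 - ⟪x, e⟫ ^ 2 / ‖x‖ ^ 2) * ⟪a, x⟫ / ‖x‖ ^ 2) • x)
      (closedAnnulus _ r R) := by
    have hne : ∀ x ∈ closedAnnulus (EuclideanSpace ℝ (Fin 3)) r R, ‖x‖ ^ 2 ≠ 0 := fun x hx =>
      pow_ne_zero 2 (hr.trans_le hx.1).ne'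
    refine ContinuousOn.integrableOn_compact (isCompact_closedAnnulus r R) ?_
    refine ContinuousOn.smul (ContinuousOn.div (ContinuousOn.mul (ContinuousOn.mul
      (hφ.comp continuous_norm.continuousOn fun x hx => hx) (continuousOn_const.sub
      (ContinuousOn.div (by fun_prop) (by fun_prop) hne))) (by fun_prop)) (by fun_prop) hne)
      continuousOn_id
  refine b.repr.injective (PiLp.ext fun i => ?_)
  rw [b.repr_apply_apply, b.repr_apply_apply, ← integral_inner hint, real_inner_smul_right]
  simp_rw [real_inner_smul_right]
  by_cases hi : i = 1
  · subst hi
    have hM2 := setIntegral_closedAnnulus_inner_sq b hr hφ ha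
    have hM22 := setIntegral_closedAnnulus_inner_sq_mul_inner_sq b hr hφ
      (show (0 : Fin 3) ≠ 1 by decide)
    rw [hb0, hb1] at hM22
    simp only [Fintype.card_fin, Nat.cast_ofNat] at hM2 hM22
    rw [hb1, real_inner_self_eq_norm_sq, ha]
    calc _ = (∫ x in closedAnnulus (EuclideanSpace ℝ (Fin 3)) r R,
            ‖x‖ ^ (-(2 * γ)) * (⟪a, x⟫ ^ 2 / ‖x‖ ^ 2)) -
          ∫ x in closedAnnulus (EuclideanSpace ℝ (Fin 3)) r R,
            ‖x‖ ^ (-(2 * γ)) * (⟪e, x⟫ ^ 2 * ⟪a, x⟫ ^ 2 / ‖x‖ ^ 4) := by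
          rw [← integral_sub
            (integrableOn_closedAnnulus_radial_mul hr hφ (by fun_prop) 2)
            (integrableOn_closedAnnulus_radial_mul hr hφ (by fun_prop) 4)]
          congr 1 with x
          rw [real_inner_comm e x]
          ring
      _ = _ := by linarith
  · have hia : ⟪b i, a⟫ = 0 := hb1 ▸ b.inner_eq_zero hi
    rw [hia, mul_zero]
    refine setIntegral_closedAnnulus_eq_zero_of_odd (a := a) (fun x => ?_) r R
    have hfix : ∀ v : EuclideanSpace ℝ (Fin 3), ⟪v, a⟫ = 0 →
        ⟪v, (ℝ ∙ a)ᗮ.reflection x⟫ = ⟪v, x⟫ := fun v hv => by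
      have hLv : (ℝ ∙ a)ᗮ.reflection v = v := Submodule.reflection_mem_subspace_eq_self
        (Submodule.mem_orthogonal_singleton_iff_inner_left.2 hv)
      rw [← LinearIsometryEquiv.inner_map_map (ℝ ∙ a)ᗮ.reflection v x, hLv]
    have hneg : ⟪a, (ℝ ∙ a)ᗮ.reflection x⟫ = -⟪a, x⟫ := by
      rw [← LinearIsometryEquiv.inner_map_map (ℝ ∙ a)ᗮ.reflection a x,
        Submodule.reflection_orthogonalComplement_singleton_eq_neg, inner_neg_left, neg_neg]
    rw [hfix _ hia, hneg, real_inner_comm e, hfix e hea, real_inner_comm e x,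
      LinearIsometryEquiv.norm_map]
    ring
end
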